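/- Let k be a positive even integer, let f : ℍ → ℂ be holomorphic, and let ε ∈ GL₂(ℝ) with det ε > 0 be elliptic, i.e. (tr ε)² < 4 det ε. If f|_k ε = f, then either ε has finite order as a fractional linear transformation of ℍ (equivalently, some positive power of ε is a scalar matrix), or f is constant. (Lemma 5.) -/

import Mathlib

open UpperHalfPlane Matrix Complex MatrixGroups Asymptotics Filter Topology
open scoped Manifold

set_option synthInstance.maxHeartbeats 1000000 in
/-- Action of a real 2×2 matrix with positive determinant on the upper
half-plane `ℍ` (junk value `z` if the determinant is not positive). -/
noncomputable def glAct (γ : Matrix (Fin 2) (Fin 2) ℝ) (z : ℍ) : ℍ :=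
  if h : 0 < γ.det then
    (⟨Matrix.GeneralLinearGroup.mkOfDetNeZero γ h.ne', by
        simpa [Matrix.GeneralLinearGroup.mkOfDetNeZero] using h⟩ : GL(2, ℝ)⁺) • z
  else z

/-- For an even integer `k`, the weight-`k` slash action
`(f ∣ₖ γ)(z) = (det γ)^(k/2) (cz+d)^(-k) f(γz)`. -/
noncomputable def slash (k : ℤ) (γ : Matrix (Fin 2) (Fin 2) ℝ) (f : ℍ → ℂ) : ℍ → ℂ :=
  fun z => (γ.det : ℂ) ^ (k / 2) * (γ 1 0 * (z : ℂ) + γ 1 1) ^ (-k) * f (glAct γ z)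

/-- An element of `SL(2, ℤ)` as a real matrix. -/
def sl2ToReal (γ : Matrix.SpecialLinearGroup (Fin 2) ℤ) : Matrix (Fin 2) (Fin 2) ℝ :=
  (γ : Matrix (Fin 2) (Fin 2) ℤ).map (Int.cast)

/-- The function `f(z) = Σ_{n ≥ 1} a_n e^{2πinz}` on the upper half-plane. -/
noncomputable def fourierSeries (a : ℕ → ℂ) : ℍ → ℂ :=
  fun z => ∑' n : ℕ, a (n + 1) *
    Complex.exp (2 * (Real.pi : ℂ) * Complex.I * ((n : ℂ) + 1) * (z : ℂ))

/-- The Dirichlet series `F(s) = Σ_{n ≥ 1} a_n n^{-s}`. -/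
noncomputable def dirichletSeries (a : ℕ → ℂ) (s : ℂ) : ℂ :=
  ∑' n : ℕ, a (n + 1) / ((n : ℂ) + 1) ^ s

/-- The action of the Hecke operator `T_p` in weight `k`:
`f|_k T_p = f|_k ((p,0),(0,1)) + Σ_{b=0}^{p-1} f|_k ((1,b),(0,p))`. -/
noncomputable def heckeT (k : ℤ) (p : ℕ) (f : ℍ → ℂ) : ℍ → ℂ :=
  fun z => slash k !![(p : ℝ), 0; 0, 1] f z +
    ∑ b ∈ Finset.range p, slash k !![1, (b : ℝ); 0, (p : ℝ)] f z

/-- The action of the Atkin–Lehner operator `U_q` in weight `k`: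
`f|_k U_q = Σ_{b=0}^{q-1} f|_k ((q,b),(0,q))`. -/
noncomputable def atkinLehnerU (k : ℤ) (q : ℕ) (f : ℍ → ℂ) : ℍ → ℂ :=
  fun z => ∑ b ∈ Finset.range q, slash k !![(q : ℝ), (b : ℝ); 0, (q : ℝ)] f z

/-- The local factor at the prime `p` of an Euler product of degree 2,
level `N`, and weight `k`. -/
noncomputable def localFactor (a : ℕ → ℂ) (N : ℕ) (k : ℤ) (p : ℕ) (s : ℂ) : ℂ :=
  if p ∣ N then
    (if p ^ 2 ∣ N then 1 else (1 - (p : ℂ) ^ ((k : ℂ) / 2 - 1 - s))⁻¹)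
  else (1 - a p * (p : ℂ) ^ (-s) + (p : ℂ) ^ ((k : ℂ) - 1 - 2 * s))⁻¹

lemma denom_ne_zero_of_det_pos {γ : Matrix (Fin 2) (Fin 2) ℝ} (hγ : 0 < γ.det) (z : ℍ) :
    (γ 1 0 * (z : ℂ) + γ 1 1 : ℂ) ≠ 0 :=
  UpperHalfPlane.denom_ne_zero (Matrix.GeneralLinearGroup.mkOfDetNeZero γ hγ.ne') z

lemma coe_glAct {γ : Matrix (Fin 2) (Fin 2) ℝ} (hγ : 0 < γ.det) (z : ℍ) :
    (glAct γ z : ℂ) = (γ 0 0 * (z : ℂ) + γ 0 1) / (γ 1 0 * (z : ℂ) + γ 1 1) := by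
  rw [glAct, dif_pos hγ]
  exact UpperHalfPlane.coe_smul_of_det_pos
    (g := Matrix.GeneralLinearGroup.mkOfDetNeZero γ hγ.ne') hγ z

/-- An elliptic matrix fixes a point of the upper half-plane. -/
lemma exists_fixedPoint_of_elliptic {γ : Matrix (Fin 2) (Fin 2) ℝ}
    (hell : γ.trace ^ 2 < 4 * γ.det) :
    ∃ z : ℍ, (γ 0 0 * (z : ℂ) + γ 0 1 : ℂ) = (γ 1 0 * (z : ℂ) + γ 1 1) * z := by
  rw [Matrix.trace_fin_two, Matrix.det_fin_two] at hell
  have hc : γ 1 0 ≠ 0 := by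
    intro h
    rw [h] at hell
    nlinarith [sq_nonneg (γ 0 0 - γ 1 1)]
  set x : ℝ := (γ 0 0 - γ 1 1) / (2 * γ 1 0) with hx
  set v : ℝ := (4 * (γ 0 0 * γ 1 1 - γ 0 1 * γ 1 0) - (γ 0 0 + γ 1 1) ^ 2) / (2 * γ 1 0) ^ 2 with hv
  have hvpos : 0 < v := div_pos (by linarith) (by positivity)
  have hsq : √v * √v = v := Real.mul_self_sqrt hvpos.le
  refine ⟨⟨⟨x, √v⟩, Real.sqrt_pos.2 hvpos⟩, ?_⟩
  have h1 : γ 1 0 * x * 2 = γ 0 0 - γ 1 1 := by rw [hx]; field_simp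
  have h2 : γ 1 0 * (x * x - v) = (γ 0 0 - γ 1 1) * x + γ 0 1 := by
    rw [hx, hv]; field_simp; ring
  apply Complex.ext
  · simp
    rw [← hsq] at h2
    linarith
  · simp
    linear_combination (-√v) * h1

/-- If `(z, 1)` is an eigenvector of a real matrix with eigenvalue `μ`, then it is an eigenvector
of its `n`-th power with eigenvalue `μ ^ n`. -/
lemma pow_eigenvector {γ : Matrix (Fin 2) (Fin 2) ℝ} {z μ : ℂ}
    (h₀ : γ 0 0 * z + γ 0 1 = μ * z) (h₁ : γ 1 0 * z + γ 1 1 = μ) (n : ℕ) :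
    ((γ ^ n) 0 0 : ℂ) * z + (γ ^ n) 0 1 = μ ^ n * z ∧
      ((γ ^ n) 1 0 : ℂ) * z + (γ ^ n) 1 1 = μ ^ n := by
  induction n with
  | zero => simp
  | succ n ih =>
    obtain ⟨i₀, i₁⟩ := ih
    simp only [pow_succ, Matrix.mul_apply, Fin.sum_univ_two, Complex.ofReal_add,
      Complex.ofReal_mul]
    constructor
    · linear_combination ((γ ^ n) 0 0 : ℂ) * h₀ + ((γ ^ n) 0 1 : ℂ) * h₁ + μ * i₀
    · linear_combination ((γ ^ n) 1 0 : ℂ) * h₀ + ((γ ^ n) 1 1 : ℂ) * h₁ + μ * i₁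

/-- A real matrix with eigenvector `(z, 1)`, where `z` is not real, and a real eigenvalue
is scalar. -/
lemma eq_smul_one_of_eigenvector {γ : Matrix (Fin 2) (Fin 2) ℝ} {z : ℂ} {r : ℝ} (hz : z.im ≠ 0)
    (h₀ : γ 0 0 * z + γ 0 1 = r * z) (h₁ : γ 1 0 * z + γ 1 1 = r) :
    γ = r • (1 : Matrix (Fin 2) (Fin 2) ℝ) := by
  have e₀ := congrArg Complex.im h₀
  have e₁ := congrArg Complex.im h₁
  have e₂ := congrArg Complex.re h₀
  have e₃ := congrArg Complex.re h₁
  simp [hz] at e₀ e₁ e₂ e₃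
  rw [e₀] at e₂
  rw [e₁] at e₃
  ext i j
  fin_cases i <;> fin_cases j <;> simp <;> linarith

/-- Comparing leading coefficients at a fixed point `z₀`: if `f` is invariant under the weight-`k`
action of `γ` and does not vanish identically near `z₀`, then its order of vanishing `n` at `z₀`
satisfies `(det γ)^(k/2) j^(-k) (det γ / j²)^n = 1`, where `j` is the automorphy factor at `z₀`. -/
lemma exists_leading_coeff_identity {k : ℤ} {f : ℍ → ℂ} {γ : Matrix (Fin 2) (Fin 2) ℝ}
    (hγ : 0 < γ.det) (hinv : slash k γ f = f) {z₀ : ℍ}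
    (hfix : (γ 0 0 * (z₀ : ℂ) + γ 0 1 : ℂ) = (γ 1 0 * (z₀ : ℂ) + γ 1 1) * z₀)
    (han : AnalyticAt ℂ (f ∘ ofComplex) z₀) (hne : ¬ ∀ᶠ w in 𝓝 (z₀ : ℂ), (f ∘ ofComplex) w = 0) :
    ∃ n : ℕ, (γ.det : ℂ) ^ (k / 2) * (γ 1 0 * (z₀ : ℂ) + γ 1 1) ^ (-k) *
      (γ.det / (γ 1 0 * (z₀ : ℂ) + γ 1 1) ^ 2) ^ n = 1 := by
  obtain ⟨n, g, hg, hg0, hfg⟩ := han.exists_eventuallyEq_pow_smul_nonzero_iff.2 hne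
  refine ⟨n, ?_⟩
  set φ : ℂ → ℂ := fun w => (γ 0 0 * w + γ 0 1) / (γ 1 0 * w + γ 1 1) with hφ
  set j : ℂ → ℂ := fun w => γ 1 0 * w + γ 1 1 with hj
  have hj0 : j z₀ ≠ 0 := denom_ne_zero_of_det_pos hγ z₀
  have hjc : Continuous j := by fun_prop
  have hφ0 : φ z₀ = z₀ := by
    simp only [hφ]
    rw [hfix, mul_div_cancel_left₀ _ hj0]
  have hφc : ContinuousAt φ z₀ := by
    refine ContinuousAt.div (by fun_prop) (by fun_prop) hj0
  have hφt : Tendsto φ (𝓝 z₀) (𝓝 z₀) := by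
    have := hφc.tendsto
    rwa [hφ0] at this
  have hev : ∀ᶠ w in 𝓝[≠] (z₀ : ℂ), g w = (γ.det : ℂ) ^ (k / 2) * j w ^ (-k) *
      (γ.det / (j w * j z₀)) ^ n * g (φ w) := by
    filter_upwards [self_mem_nhdsWithin, nhdsWithin_le_nhds hfg,
      nhdsWithin_le_nhds (hφt.eventually hfg),
      nhdsWithin_le_nhds (isOpen_upperHalfPlaneSet.mem_nhds z₀.im_pos)] with w hw h1 h2 him
    have hjw : j w ≠ 0 := denom_ne_zero_of_det_pos hγ ⟨w, him⟩
    have hsub : w - z₀ ≠ 0 := sub_ne_zero.2 hw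
    have hdiff : φ w - z₀ = γ.det / (j w * j z₀) * (w - z₀) := by
      have e : φ w * j w = γ 0 0 * w + γ 0 1 := div_mul_cancel₀ _ hjw
      have hdet : (γ.det : ℂ) = γ 0 0 * γ 1 1 - γ 0 1 * γ 1 0 := by
        rw [Matrix.det_fin_two]; push_cast; ring
      rw [div_mul_eq_mul_div, eq_div_iff (mul_ne_zero hjw hj0)]
      have hfix' : (γ 0 0 * (z₀ : ℂ) + γ 0 1 : ℂ) = j z₀ * z₀ := hfix
      rw [hdet]
      simp only [hj] at e hfix' ⊢
      linear_combination (γ 1 0 * (z₀ : ℂ) + γ 1 1 : ℂ) * e + (γ 1 0 * w + γ 1 1 : ℂ) * hfix'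
    have hφw : ((glAct γ ⟨w, him⟩ : ℍ) : ℂ) = φ w := coe_glAct hγ _
    have key := congrFun hinv ⟨w, him⟩
    have h1' : f ⟨w, him⟩ = (w - z₀) ^ n * g w := by
      simpa [ofComplex_apply_of_im_pos him] using h1
    have h2' : f (glAct γ ⟨w, him⟩) = (φ w - z₀) ^ n * g (φ w) := by
      rw [← hφw, Function.comp_apply, ofComplex_apply, hφw, smul_eq_mul] at h2
      exact h2
    rw [slash, h2', h1', hdiff, mul_pow] at key
    apply mul_left_cancel₀ (pow_ne_zero n hsub)
    rw [← key]
    simp only [hj]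
    ring
  have hlim : Tendsto (fun w => (γ.det : ℂ) ^ (k / 2) * j w ^ (-k) *
      (γ.det / (j w * j z₀)) ^ n * g (φ w)) (𝓝 z₀)
      (𝓝 ((γ.det : ℂ) ^ (k / 2) * j z₀ ^ (-k) * (γ.det / (j z₀ * j z₀)) ^ n * g z₀)) := by
    refine Tendsto.mul (Tendsto.mul (Tendsto.mul tendsto_const_nhds ?_) ?_)
      (hg.continuousAt.tendsto.comp hφt)
    · exact (hjc.tendsto _).zpow₀ _ (Or.inl hj0)
    · exact ((tendsto_const_nhds.div ((hjc.tendsto _).mul tendsto_const_nhds)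
        (mul_ne_zero hj0 hj0))).pow n
  have := tendsto_nhds_unique_of_eventuallyEq
    (hg.continuousAt.tendsto.mono_left nhdsWithin_le_nhds)
    (hlim.mono_left nhdsWithin_le_nhds) hev
  rw [← pow_two] at this
  exact mul_right_cancel₀ hg0 (by rw [one_mul]; exact this.symm)

/-- **Lemma 5.** If `f` is holomorphic on `ℍ`, `ε ∈ GL₂(ℝ)⁺` is elliptic
(i.e. `(tr ε)² < 4 det ε`), and `f|_k ε = f`, then either some positive power
of `ε` is a scalar matrix (i.e. `ε` has finite order as a fractional linear
transformation), or `f` is constant. -/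
theorem lemma_five
    (k : ℤ) (hkpos : 0 < k) (hkeven : Even k)
    (f : ℍ → ℂ) (hf : MDifferentiable 𝓘(ℂ) 𝓘(ℂ) f)
    (ε : Matrix (Fin 2) (Fin 2) ℝ) (hdet : 0 < ε.det)
    (hell : ε.trace ^ 2 < 4 * ε.det)
    (hinv : slash k ε f = f) :
    (∃ n : ℕ, 0 < n ∧ ∃ c : ℝ, ε ^ n = c • (1 : Matrix (Fin 2) (Fin 2) ℝ)) ∨
    (∃ c : ℂ, f = fun _ => c) := by
  obtain ⟨z₀, hfix⟩ := exists_fixedPoint_of_elliptic hell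
  have han : AnalyticOnNhd ℂ (f ∘ ofComplex) {z | 0 < z.im} :=
    (UpperHalfPlane.mdifferentiable_iff.1 hf).analyticOnNhd isOpen_upperHalfPlaneSet
  by_cases hzero : ∀ᶠ w in 𝓝 (z₀ : ℂ), (f ∘ ofComplex) w = 0
  · refine Or.inr ⟨0, funext fun z => ?_⟩
    have := han.eqOn_zero_of_preconnected_of_eventuallyEq_zero
      (convex_halfSpace_im_gt 0).isPreconnected z₀.im_pos hzero z.im_pos
    simpa [ofComplex_apply] using this
  · left
    obtain ⟨n, hn⟩ := exists_leading_coeff_identity hdet hinv hfix (han z₀ z₀.im_pos) hzero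
    have hj0 := denom_ne_zero_of_det_pos hdet z₀
    set μ : ℂ := ε 1 0 * (z₀ : ℂ) + ε 1 1 with hμ
    obtain ⟨l, rfl⟩ := hkeven
    lift l to ℕ using by lia
    have hl : ((l : ℤ) + l) / 2 = l := by lia
    have hpow : μ ^ (2 * (l + n)) = ((ε.det ^ (l + n) : ℝ) : ℂ) := by
      rw [hl, _root_.zpow_neg, ← Nat.cast_add, zpow_natCast, zpow_natCast, div_pow] at hn
      field_simp at hn
      push_cast
      rw [pow_add _ l n, hn]
      ring_nf
    obtain ⟨e₀, e₁⟩ := pow_eigenvector hfix hμ.symm (2 * (l + n))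
    rw [hpow] at e₀ e₁
    exact ⟨2 * (l + n), by lia, _, eq_smul_one_of_eigenvector z₀.im_ne_zero e₀ e₁⟩
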